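/- arXiv:1905.06199 — 4 statements merged into one kernel-verified Lean document; each statement's English description precedes it below -/
import Mathlib

section
/- Suppose a group H acts by graph automorphisms on a countable simple graph Γ, cocompactly in the sense that there are only finitely many H-orbits of vertices and of edges, and suppose every vertex of Γ has degree at most k. Then there exists an H-invariant Borel probability measure μ on the compact space [k+1]^{V(Γ)} (with the product topology) such that μ(C_{k+1}(Γ)) = 1; that is, there exists an H-invariant probability measure concentrated on the set of proper (k+1)-colourings of Γ. -/
open MeasureTheory

/-- A colour outside `s`, if there is one. -/
noncomputable def freshColour {k : ℕ} (s : Set (Fin (k + 1))) : Fin (k + 1) :=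
  open Classical in if h : ∃ i, i ∉ s then h.choose else 0

theorem freshColour_notMem {k : ℕ} {s : Set (Fin (k + 1))} (hs : s.ncard ≤ k) :
    freshColour s ∉ s := by
  have h : ∃ i, i ∉ s := by
    by_contra! h
    rw [Set.eq_univ_of_forall h, Set.ncard_univ, Nat.card_fin] at hs
    omega
  rw [freshColour, dif_pos h]
  exact h.choose_spec

theorem measurable_freshColour {k : ℕ} :
    Measurable (freshColour : Set (Fin (k + 1)) → Fin (k + 1)) :=
  have : MeasurableSingletonClass (Set (Fin (k + 1))) :=
    inferInstanceAs (MeasurableSingletonClass (Fin (k + 1) → Prop))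
  measurable_of_countable _

theorem measurable_nat_sInf {α : Type*} [MeasurableSpace α] {S : α → Set ℕ}
    (hS : ∀ n, Measurable fun x => n ∈ S x) : Measurable fun x => sInf (S x) := by
  classical
  have hex (x : α) : ∃ n, n ∈ S x ∨ ∀ m, m ∉ S x := by
    by_cases h : ∃ n, n ∈ S x
    · exact h.imp fun n hn => .inl hn
    · exact ⟨0, .inr (not_exists.1 h)⟩
  have hfind : (fun x => sInf (S x)) = fun x => Nat.find (hex x) := by
    funext x
    by_cases h : (S x).Nonempty
    · rw [Nat.sInf_def h]
      exact Nat.find_congr' fun {n} => ⟨.inl, fun hn => hn.resolve_right fun h' => h.elim h'⟩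
    · have hempty : sInf (S x) = 0 := by simp [Set.not_nonempty_iff_eq_empty.1 h]
      rw [hempty, eq_comm, Nat.find_eq_zero]
      exact .inr fun m hm => h ⟨m, hm⟩
  rw [hfind]
  exact measurable_find hex fun n =>
    measurableSet_setOfPred.2 ((hS n).or (Measurable.forall fun m => (hS m).not))

namespace SimpleGraph

variable {V : Type*} (Γ : SimpleGraph V) (k : ℕ)

/-- The `n`-th approximation to the greedy colouring of `Γ` along the ordering of the vertices
by the values of `t`. -/
noncomputable def greedyStage (t : V → ℕ) : ℕ → V → Fin (k + 1)
  | 0, _ => 0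
  | n + 1, v => freshColour {i | ∃ w, (Γ.Adj v w ∧ t w < t v) ∧ greedyStage t n w = i}

/-- The greedy colouring of `Γ` along the ordering of the vertices by the values of `t`. -/
noncomputable def greedyColouring (t : V → ℕ) (v : V) : Fin (k + 1) :=
  Γ.greedyStage k t (t v + 1) v

variable {Γ k}

theorem greedyStage_eq_greedyColouring {t : V → ℕ} {n : ℕ} {v : V} (h : t v < n) :
    Γ.greedyStage k t n v = Γ.greedyColouring k t v := by
  induction n using Nat.strong_induction_on generalizing v with
  | _ n ih =>
    obtain ⟨m, rfl⟩ : ∃ m, n = m + 1 := ⟨n - 1, by omega⟩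
    rcases (Nat.lt_succ_iff.1 h).eq_or_lt with hm | hm
    · rw [greedyColouring, hm]
    · rw [greedyColouring, greedyStage, greedyStage]
      congr 1
      ext i
      refine exists_congr fun w => and_congr_right fun hw => ?_
      rw [ih m (by omega) (by omega), ih (t v) (by omega) hw.2]

theorem greedyColouring_ne {t : V → ℕ} (hfin : ∀ v, (Γ.neighborSet v).Finite)
    (hdeg : ∀ v, (Γ.neighborSet v).ncard ≤ k) {v w : V} (hvw : Γ.Adj v w) (ht : t w < t v) :
    Γ.greedyColouring k t v ≠ Γ.greedyColouring k t w := by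
  rw [greedyColouring, greedyStage]
  set s := {i | ∃ w, (Γ.Adj v w ∧ t w < t v) ∧ Γ.greedyStage k t (t v) w = i} with hs
  have hsub : s ⊆ Γ.greedyStage k t (t v) '' Γ.neighborSet v := by
    rintro i ⟨u, hu, rfl⟩
    exact ⟨u, hu.1, rfl⟩
  have hcard : s.ncard ≤ k :=
    (Set.ncard_le_ncard hsub ((hfin v).image _)).trans
      ((Set.ncard_image_le (hfin v)).trans (hdeg v))
  intro h
  apply freshColour_notMem hcard
  rw [h, hs]
  exact ⟨w, ⟨hvw, ht⟩, greedyStage_eq_greedyColouring ht⟩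

theorem greedyStage_comp_equiv (e : V ≃ V) (he : ∀ v w, Γ.Adj (e v) (e w) ↔ Γ.Adj v w)
    (t : V → ℕ) (n : ℕ) (v : V) :
    Γ.greedyStage k (t ∘ e) n v = Γ.greedyStage k t n (e v) := by
  induction n generalizing v with
  | zero => rfl
  | succ n ih =>
    simp only [greedyStage]
    congr 1
    ext i
    simp only [Set.mem_ofPred_eq, ih, ← he v, Function.comp_apply]
    exact e.exists_congr_left.trans (by simp)

theorem greedyColouring_comp_equiv (e : V ≃ V) (he : ∀ v w, Γ.Adj (e v) (e w) ↔ Γ.Adj v w)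
    (t : V → ℕ) :
    Γ.greedyColouring k (t ∘ e) = Γ.greedyColouring k t ∘ e :=
  funext fun v => greedyStage_comp_equiv e he t _ v

theorem measurable_greedyStage [Countable V] (n : ℕ) (v : V) :
    Measurable fun t : V → ℕ => Γ.greedyStage k t n v := by
  induction n generalizing v with
  | zero => exact measurable_const
  | succ n ih =>
    refine measurable_freshColour.comp (measurable_set_iff.2 fun i => ?_)
    refine Measurable.exists fun w => Measurable.and (Measurable.and measurable_const ?_) ?_
    · exact measurableSet_setOfPred.1
        (measurableSet_lt (measurable_pi_apply w) (measurable_pi_apply v))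
    · exact measurableSet_setOfPred.1 (measurableSet_eq_fun (ih w) measurable_const)

theorem measurable_greedyColouring [Countable V] :
    Measurable fun t : V → ℕ => Γ.greedyColouring k t := by
  refine measurable_pi_iff.2 fun v => ?_
  have h : Measurable fun p : (V → ℕ) × ℕ => Γ.greedyStage k p.1 p.2 v :=
    measurable_from_prod_countable_left fun n => measurable_greedyStage n v
  exact h.comp (measurable_id.prodMk ((measurable_pi_apply v).add_const 1))

/-- The least index of a set of the sequence `B` that contains the label of `v` and none of the
labels of its neighbours. -/
noncomputable def separatingIndex {X : Type*} (Γ : SimpleGraph V) (B : ℕ → Set X) (x : V → X)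
    (v : V) : ℕ :=
  sInf {n | x v ∈ B n ∧ ∀ w, Γ.Adj v w → x w ∉ B n}

section separatingIndex

variable {X : Type*} {B : ℕ → Set X}

theorem separatingIndex_comp_equiv (e : V ≃ V) (he : ∀ v w, Γ.Adj (e v) (e w) ↔ Γ.Adj v w)
    (x : V → X) :
    Γ.separatingIndex B (x ∘ e) = Γ.separatingIndex B x ∘ e := by
  funext v
  simp only [separatingIndex, Function.comp_apply, ← he v]
  congr! 4 with n
  exact e.forall_congr_left.trans (by simp)

theorem separatingIndex_ne [TopologicalSpace X] [T1Space X]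
    (hB : TopologicalSpace.IsTopologicalBasis (Set.range B))
    (hfin : ∀ v, (Γ.neighborSet v).Finite) {x : V → X} (hx : Function.Injective x)
    {v w : V} (hvw : Γ.Adj v w) :
    Γ.separatingIndex B x v ≠ Γ.separatingIndex B x w := by
  have key (v : V) : Γ.separatingIndex B x v ∈
      {n | x v ∈ B n ∧ ∀ w, Γ.Adj v w → x w ∉ B n} := by
    refine Nat.sInf_mem ?_
    obtain ⟨_, ⟨n, rfl⟩, hn, hsub⟩ := hB.exists_subset_of_mem_open
      (a := x v) (u := (x '' Γ.neighborSet v)ᶜ)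
      (by
        rintro ⟨w, hw, h⟩
        exact (hx h ▸ hw : Γ.Adj v w).ne (hx h).symm)
      ((hfin v).image x).isClosed.isOpen_compl
    exact ⟨n, hn, fun w hw hmem => hsub hmem ⟨w, hw, rfl⟩⟩
  intro h
  exact (key v).2 w hvw (h ▸ (key w).1)

theorem measurable_separatingIndex [Countable V] [MeasurableSpace X]
    (hB : ∀ n, MeasurableSet (B n)) :
    Measurable fun x : V → X => Γ.separatingIndex B x := by
  refine measurable_pi_iff.2 fun v => measurable_nat_sInf fun n => ?_
  exact (measurableSet_setOfPred.1 (measurable_pi_apply v (hB n))).and <|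
    Measurable.forall fun w => measurable_const.imp
      (measurableSet_setOfPred.1 (measurable_pi_apply w (hB n))).not

end separatingIndex

end SimpleGraph

/-- The coordinates of a point of a product of copies of a diffuse measure are almost surely
distinct. -/
theorem ae_injective_infinitePi {V X : Type*} [Countable V] [MeasurableSpace X] [MeasurableEq X]
    (ν : Measure X) [IsProbabilityMeasure ν] [NullSingletonClass ν] :
    ∀ᵐ x ∂(Measure.infinitePi fun _ : V => ν), Function.Injective x := by
  have h : ∀ v w : V, v ≠ w → ∀ᵐ x ∂(Measure.infinitePi fun _ : V => ν), x v ≠ x w := by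
    intro v w hvw
    have hd : ∀ᵐ p ∂(ν.prod ν), p.1 ≠ p.2 := by
      refine (Measure.ae_prod_iff_ae_ae ?_).2 (.of_forall fun a => ?_)
      · exact measurableSet_diagonal.compl
      · filter_upwards [compl_mem_ae_iff.2 (measure_singleton (μ := ν) a)] with b hb hab
        exact hb hab.symm
    rw [← Measure.infinitePi_map_eval_prod (P := fun _ : V => ν) hvw] at hd
    exact ae_of_ae_map (f := fun x : V → X => (x v, x w)) (by fun_prop) hd
  have h' : ∀ᵐ x ∂(Measure.infinitePi fun _ : V => ν), ∀ v w : V, v ≠ w → x v ≠ x w := by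
    simpa only [ae_all_iff] using h
  filter_upwards [h'] with x hx v w hvw
  by_contra hne
  exact hx v w hne hvw

/-- **Existence of an invariant colouring measure** (Agol / Theorem 5.3).
Suppose a group `H` acts by graph automorphisms on a countable simple graph `Γ` on vertex
set `V`, cocompactly (finitely many orbits of vertices and of edges), and every vertex has
degree at most `k`.  Then there is an `H`-invariant Borel probability measure on the space
`[k+1]^V` (product of discrete spaces) giving full measure to the set of proper
`(k+1)`-colourings of `Γ`. -/
theorem invariant_colouring_measure
    {V : Type} [Countable V] (Γ : SimpleGraph V)
    {H : Type} [Group H] [MulAction H V]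
    (hadj : ∀ (h : H) (v w : V), Γ.Adj v w → Γ.Adj (h • v) (h • w))
    (k : ℕ)
    (hfin : ∀ v : V, (Γ.neighborSet v).Finite)
    (hdeg : ∀ v : V, (Γ.neighborSet v).ncard ≤ k)
    (hcocompactV : ∃ V₀ : Finset V, ∀ v : V, ∃ h : H, ∃ v₀ ∈ V₀, h • v₀ = v)
    (hcocompactE : ∃ E₀ : Finset (V × V), ∀ v w : V, Γ.Adj v w →
      ∃ h : H, ∃ p ∈ E₀, h • p.1 = v ∧ h • p.2 = w) :
    ∃ μ : Measure (V → Fin (k + 1)),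
      IsProbabilityMeasure μ ∧
      (∀ h : H, μ.map (fun f => fun v => f (h⁻¹ • v)) = μ) ∧
      μ {f : V → Fin (k + 1) | ∀ v w : V, Γ.Adj v w → f v ≠ f w} = 1 := by
  obtain ⟨B, hB⟩ := TopologicalSpace.exists_seq_basis unitInterval
  set P : Measure (V → unitInterval) := Measure.infinitePi fun _ => volume
  set G : (V → unitInterval) → V → Fin (k + 1) :=
    fun x => Γ.greedyColouring k (Γ.separatingIndex B x) with hG
  have hGm : Measurable G := SimpleGraph.measurable_greedyColouring.comp
    (SimpleGraph.measurable_separatingIndex fun n => (hB.isOpen ⟨n, rfl⟩).measurableSet)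
  have hprob : IsProbabilityMeasure (P.map G) := Measure.isProbabilityMeasure_map hGm.aemeasurable
  refine ⟨P.map G, hprob, fun h => ?_, ?_⟩
  · let e : V ≃ V := MulAction.toPerm h⁻¹
    have he (v w : V) : Γ.Adj (e v) (e w) ↔ Γ.Adj v w :=
      ⟨fun hvw => by simpa [e] using hadj h _ _ hvw, hadj h⁻¹ v w⟩
    have hcomm : (fun f : V → Fin (k + 1) => f ∘ e) ∘ G = G ∘ fun x => x ∘ e := by
      funext x
      simp only [Function.comp_apply, hG]
      rw [SimpleGraph.separatingIndex_comp_equiv e he, SimpleGraph.greedyColouring_comp_equiv e he]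
    have hinv : P.map (fun x => x ∘ e) = P :=
      Measure.map_infinitePi_infinitePi_of_inj e.injective
    change (P.map G).map (fun f => f ∘ e) = P.map G
    rw [Measure.map_map (by fun_prop) hGm, hcomm, ← Measure.map_map hGm (by fun_prop), hinv]
  · have hmeas : MeasurableSet
        {f : V → Fin (k + 1) | ∀ v w : V, Γ.Adj v w → f v ≠ f w} :=
      measurableSet_setOfPred.2 <| Measurable.forall fun v => Measurable.forall fun w =>
        measurable_const.imp (measurableSet_setOfPred.1
          (measurableSet_eq_fun (measurable_pi_apply v) (measurable_pi_apply w))).not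
    rw [← mem_ae_iff_prob_eq_one hmeas]
    refine (ae_map_iff hGm.aemeasurable hmeas).2 ?_
    filter_upwards [ae_injective_infinitePi (V := V) (volume : Measure unitInterval)]
      with x hx v w hvw
    rcases (SimpleGraph.separatingIndex_ne hB hfin hx hvw).lt_or_gt with h | h
    · exact (SimpleGraph.greedyColouring_ne hfin hdeg hvw.symm h).symm
    · exact SimpleGraph.greedyColouring_ne hfin hdeg hvw h
end

section
/- Let Γ be a simple graph all of whose vertex degrees are at most k, and let n ≥ k+2. Define p_n : [n]^{V(Γ)} → [n−1]^{V(Γ)} by p_n(c)(v) = c(v) if c(v) < n, and p_n(c)(v) = min([n−1] − {c(u) : u adjacent to v}) if c(v) = n (this minimum exists because v has at most k ≤ n−2 neighbours). Then for every c ∈ [n]^{V(Γ)} and every edge {v₁,v₂} of Γ, if p_n(c)(v₁) = p_n(c)(v₂) then c(v₁) = c(v₂); equivalently, p_n⁻¹(B_e(n−1)) ⊆ B_e(n) for every edge e of Γ. -/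
/-- The recolouring map `p_n : [n]^V → [n-1]^V`: a vertex coloured `n` is recoloured with
the smallest colour in `[n-1] = {1,…,n-1}` not used by any of its neighbours, and all other
vertices keep their colour.  (Colours are natural numbers; `[n]` is `Finset.Icc 1 n`.) -/
noncomputable def recolour {V : Type} (Γ : SimpleGraph V) (n : ℕ) (c : V → ℕ) : V → ℕ :=
  fun v =>
    if c v < n then c v
    else sInf {m : ℕ | m ∈ Finset.Icc 1 (n - 1) ∧ ∀ u : V, Γ.Adj u v → c u ≠ m}

/-- A colour of `[n-1]` avoided by all neighbours of `v` exists when `v` has at most `n - 2`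
neighbours. -/
theorem exists_colour_avoiding_neighbors {V : Type} (Γ : SimpleGraph V) (n : ℕ) (c : V → ℕ)
    (v : V) (hfin : (Γ.neighborSet v).Finite) (hdeg : (Γ.neighborSet v).ncard + 2 ≤ n) :
    ∃ m ∈ Finset.Icc 1 (n - 1), ∀ u : V, Γ.Adj u v → c u ≠ m := by
  classical
  have hcard : (hfin.toFinset.image c).card < (Finset.Icc 1 (n - 1)).card := by
    have himage : (hfin.toFinset.image c).card ≤ hfin.toFinset.card := Finset.card_image_le
    rw [← Set.ncard_eq_toFinset_card _ hfin] at himage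
    rw [Nat.card_Icc]
    omega
  obtain ⟨m, hm, hnot⟩ := Finset.exists_mem_notMem_of_card_lt_card hcard
  refine ⟨m, hm, fun u hu h => hnot ?_⟩
  exact Finset.mem_image.2 ⟨u, hfin.mem_toFinset.2 hu.symm, h⟩

/-- A recoloured vertex gets a colour different from the old colours of its neighbours. -/
theorem recolour_ne_of_adj {V : Type} (Γ : SimpleGraph V) (n : ℕ) (c : V → ℕ) {u v : V}
    (hfin : (Γ.neighborSet v).Finite) (hdeg : (Γ.neighborSet v).ncard + 2 ≤ n)
    (hv : ¬ c v < n) (huv : Γ.Adj u v) : c u ≠ recolour Γ n c v := by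
  simp only [recolour, if_neg hv]
  exact (Nat.sInf_mem (exists_colour_avoiding_neighbors Γ n c v hfin hdeg)).2 u huv

/-- If all vertex degrees of `Γ` are at most `k` and `n ≥ k+2`, then for every
`c ∈ [n]^V` and every edge `{v₁, v₂}` of `Γ`: if `p_n(c)(v₁) = p_n(c)(v₂)` then
`c(v₁) = c(v₂)`.  Equivalently `p_n⁻¹(B_e(n-1)) ⊆ B_e(n)` for every edge `e`. -/
theorem recolour_monochromatic_edge
    {V : Type} (Γ : SimpleGraph V) (k n : ℕ)
    (hfin : ∀ v : V, (Γ.neighborSet v).Finite)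
    (hdeg : ∀ v : V, (Γ.neighborSet v).ncard ≤ k)
    (hn : k + 2 ≤ n)
    (c : V → ℕ) (hc : ∀ v : V, c v ∈ Finset.Icc 1 n) :
    ∀ v₁ v₂ : V, Γ.Adj v₁ v₂ →
      recolour Γ n c v₁ = recolour Γ n c v₂ → c v₁ = c v₂ := by
  intro v₁ v₂ hadj heq
  have hdeg' : ∀ v : V, (Γ.neighborSet v).ncard + 2 ≤ n := fun v =>
    (Nat.add_le_add_right (hdeg v) 2).trans hn
  have hle : ∀ v : V, c v ≤ n := fun v => (Finset.mem_Icc.1 (hc v)).2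
  have hkeep : ∀ v : V, c v < n → recolour Γ n c v = c v := fun v hv => if_pos hv
  by_cases h₁ : c v₁ < n <;> by_cases h₂ : c v₂ < n
  · rwa [hkeep v₁ h₁, hkeep v₂ h₂] at heq
  · rw [hkeep v₁ h₁] at heq
    exact absurd heq (recolour_ne_of_adj Γ n c (hfin v₂) (hdeg' v₂) h₂ hadj)
  · rw [hkeep v₂ h₂] at heq
    exact absurd heq.symm (recolour_ne_of_adj Γ n c (hfin v₁) (hdeg' v₁) h₁ hadj.symm)
  · exact (le_antisymm (hle v₁) (not_lt.1 h₁)).trans (le_antisymm (hle v₂) (not_lt.1 h₂)).symm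
end

section
/- Let Γ be a simple graph all of whose vertex degrees are at most k, let n ≥ k+2, and let p_n : [n]^{V(Γ)} → [n−1]^{V(Γ)} be the map defined by p_n(c)(v) = c(v) if c(v) < n, and p_n(c)(v) = min([n−1] − {c(u) : u adjacent to v}) if c(v) = n. Then p_n is continuous with respect to the product topologies (each factor discrete), and p_n is equivariant for the automorphism group of Γ: p_n(c∘g⁻¹) = p_n(c)∘g⁻¹ for every graph automorphism g of Γ and every c ∈ [n]^{V(Γ)}. -/
/-- The recoloured value at `v` depends only on the colours of `v` and its neighbours. -/
theorem recolour_apply_congr {V : Type} (Γ : SimpleGraph V) (n : ℕ) {c d : V → ℕ} {v : V}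
    (hv : c v = d v) (hN : ∀ u ∈ Γ.neighborSet v, c u = d u) :
    recolour Γ n c v = recolour Γ n d v := by
  have hset : {m : ℕ | m ∈ Finset.Icc 1 (n - 1) ∧ ∀ u : V, Γ.Adj u v → c u ≠ m} =
      {m : ℕ | m ∈ Finset.Icc 1 (n - 1) ∧ ∀ u : V, Γ.Adj u v → d u ≠ m} := by
    ext m
    refine and_congr_right fun _ => forall₂_congr fun u hu => ?_
    rw [hN u hu.symm]
  simp only [recolour, hv, hset]

theorem continuous_recolour {V : Type} (Γ : SimpleGraph V) (n : ℕ)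
    (hfin : ∀ v : V, (Γ.neighborSet v).Finite) : Continuous (recolour Γ n) := by
  refine continuous_pi fun v => continuous_iff_continuousAt.2 fun c => ?_
  have hcoord (u : V) : ∀ᶠ d : V → ℕ in nhds c, c u = d u :=
    ((continuous_apply u).tendsto c).eventually
      (show ∀ᶠ m in nhds (c u), c u = m by simp [nhds_discrete])
  refine continuousAt_const.congr (f := fun _ => recolour Γ n c v) ?_
  filter_upwards [hcoord v, (hfin v).eventually_all.2 fun u _ => hcoord u] with d hv hN
  exact recolour_apply_congr Γ n hv hN

theorem recolour_comp_symm {V : Type} (Γ : SimpleGraph V) (n : ℕ) (g : Γ ≃g Γ) (c : V → ℕ) :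
    recolour Γ n (fun v => c (g.symm v)) = fun v => recolour Γ n c (g.symm v) := by
  funext v
  have hset : {m : ℕ | m ∈ Finset.Icc 1 (n - 1) ∧ ∀ u : V, Γ.Adj u v → c (g.symm u) ≠ m} =
      {m : ℕ | m ∈ Finset.Icc 1 (n - 1) ∧ ∀ u : V, Γ.Adj u (g.symm v) → c u ≠ m} := by
    ext m
    refine and_congr_right fun _ => ?_
    rw [← g.symm.toEquiv.forall_congr_right (q := fun w => Γ.Adj w (g.symm v) → c w ≠ m)]
    exact forall_congr' fun u => imp_congr_left g.symm.map_adj_iff.symm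
  simp only [recolour, hset]

/-- If all vertex degrees of `Γ` are at most `k` and `n ≥ k+2`, then the map
`p_n : [n]^V → [n-1]^V` is continuous for the product topologies (each factor discrete),
and is equivariant for the automorphism group of `Γ`:
`p_n (c ∘ g⁻¹) = p_n (c) ∘ g⁻¹` for every automorphism `g` of `Γ` and every `c ∈ [n]^V`. -/
theorem recolour_continuous_and_equivariant
    {V : Type} (Γ : SimpleGraph V) (k n : ℕ)
    (hfin : ∀ v : V, (Γ.neighborSet v).Finite)
    (hdeg : ∀ v : V, (Γ.neighborSet v).ncard ≤ k)
    (hn : k + 2 ≤ n) :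
    Continuous (fun c : {c : V → ℕ // ∀ v : V, c v ∈ Finset.Icc 1 n} =>
      recolour Γ n c.val) ∧
    ∀ (g : Γ ≃g Γ) (c : V → ℕ), (∀ v : V, c v ∈ Finset.Icc 1 n) →
      recolour Γ n (fun v => c (g.symm v)) = fun v => recolour Γ n c (g.symm v) := by
  exact ⟨(continuous_recolour Γ n hfin).comp continuous_subtype_val,
    fun g c _ => recolour_comp_symm Γ n g c⟩
end

section
/- Let A be an m × n matrix with integer entries, viewed as a linear map ℝⁿ → ℝᵐ. If there exists a nonzero vector v ∈ ker(A) all of whose entries are nonnegative, then there exists a nonzero vector w ∈ ker(A) all of whose entries are nonnegative integers. -/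
/-- On a finitely generated `ℚ`-subspace of `ℝ`, some `ℚ`-linear functional with rational values
is positive on any prescribed finite family of positive elements. -/
theorem exists_rat_linearMap_pos {ι : Type*} [Finite ι] (W : Submodule ℚ ℝ)
    [Module.Finite ℚ W] (x : ι → W) :
    ∃ φ : W →ₗ[ℚ] ℚ, ∀ i, 0 < (x i : ℝ) → 0 < φ (x i) := by
  let B := Module.finBasis ℚ W
  let U : Set (Fin (Module.finrank ℚ W) → ℝ) :=
    {y | ∀ i, 0 < (x i : ℝ) → 0 < ∑ j, (B.repr (x i) j : ℝ) * y j}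
  have hU : IsOpen U := by
    simp only [U, Set.ofPred_forall]
    exact isOpen_iInter_of_finite fun i => isOpen_iInter_of_finite fun _ =>
      isOpen_lt continuous_const (by fun_prop)
  have hB : (fun j => (B j : ℝ)) ∈ U := by
    intro i hi
    have h := congrArg (Subtype.val : W → ℝ) (B.sum_repr (x i))
    simp only [AddSubmonoidClass.coe_finsetSum, Submodule.coe_smul, Rat.smul_def] at h
    rwa [h]
  have hd : DenseRange (Pi.map fun (_ : Fin (Module.finrank ℚ W)) (q : ℚ) => (q : ℝ)) :=
    DenseRange.piMap fun _ => Rat.denseRange_cast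
  obtain ⟨q, hq⟩ := hd.exists_mem_open hU ⟨_, hB⟩
  refine ⟨B.constr ℚ q, fun i hi => ?_⟩
  have h := hq i hi
  rw [B.constr_apply_fintype ℚ]
  simp only [Pi.map_apply, Module.Basis.equivFun_apply, smul_eq_mul] at h ⊢
  exact_mod_cast h

/-- A finite family of nonnegative rationals has a common positive integer multiple with values
in the natural numbers. -/
theorem exists_pos_mul_eq_natCast {ι : Type*} [Fintype ι] (u : ι → ℚ) (hu : ∀ i, 0 ≤ u i) :
    ∃ d : ℕ, 0 < d ∧ ∀ i, ∃ z : ℕ, (d : ℚ) * u i = z := by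
  refine ⟨∏ i, (u i).den, Finset.prod_pos fun i _ => (u i).den_pos, fun i => ?_⟩
  obtain ⟨c, hc⟩ := Finset.dvd_prod_of_mem (fun i => (u i).den) (Finset.mem_univ i)
  refine ⟨(u i).num.toNat * c, ?_⟩
  have hnum : (((u i).num.toNat : ℤ) : ℚ) = (u i).num := by
    rw [Int.toNat_of_nonneg (Rat.num_nonneg.mpr (hu i))]
  rw [hc]
  push_cast at hnum ⊢
  rw [hnum, ← Rat.mul_den_eq_num]
  ring


/-- If an integer matrix `A`, viewed as a linear map `ℝⁿ → ℝᵐ`, has a nonzero vector in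
its kernel with all entries nonnegative, then it has a nonzero vector in its kernel all
of whose entries are nonnegative integers. -/
theorem integer_kernel_vector
    {m n : ℕ} (A : Matrix (Fin m) (Fin n) ℤ)
    (v : Fin n → ℝ) (hv : v ≠ 0)
    (hker : (A.map (Int.cast : ℤ → ℝ)).mulVec v = 0)
    (hnn : ∀ i, 0 ≤ v i) :
    ∃ w : Fin n → ℝ, w ≠ 0 ∧ (A.map (Int.cast : ℤ → ℝ)).mulVec w = 0 ∧
      ∀ i, ∃ z : ℕ, w i = (z : ℝ) := by
  classical
  let W : Submodule ℚ ℝ := Submodule.span ℚ (Set.range v)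
  have : Module.Finite ℚ W := Module.Finite.span_of_finite ℚ (Set.finite_range v)
  let x : Fin n → W := fun i => ⟨v i, Submodule.subset_span ⟨i, rfl⟩⟩
  obtain ⟨φ, hφ⟩ := exists_rat_linearMap_pos W x
  have hφ_nonneg (i : Fin n) : 0 ≤ φ (x i) := by
    rcases (hnn i).eq_or_lt with h | h
    · have hx : x i = 0 := Subtype.ext h.symm
      simp [hx]
    · exact (hφ i h).le
  have hφ_ker (r : Fin m) : ∑ i, (A r i : ℚ) * φ (x i) = 0 := by
    have hx : ∑ i, (A r i : ℚ) • x i = 0 := by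
      apply Subtype.ext
      have h := congrFun hker r
      simpa [Matrix.mulVec, dotProduct, x, Rat.smul_def] using h
    simpa using congrArg φ hx
  obtain ⟨d, hd, hz⟩ := exists_pos_mul_eq_natCast (fun i => φ (x i)) hφ_nonneg
  refine ⟨fun i => ((d * φ (x i) : ℚ) : ℝ), ?_, ?_, fun i => ?_⟩
  · obtain ⟨i, hi⟩ := Function.ne_iff.mp hv
    have hpos := hφ i (lt_of_le_of_ne (hnn i) (Ne.symm hi))
    refine Function.ne_iff.mpr ⟨i, ?_⟩
    have : (d : ℚ) * φ (x i) ≠ 0 := by positivity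
    simpa only [Pi.zero_apply, ne_eq, Rat.cast_eq_zero] using this
  · funext r
    have h : ∑ i, (A r i : ℚ) * (d * φ (x i)) = 0 := by
      simp_rw [mul_left_comm _ (d : ℚ), ← Finset.mul_sum, hφ_ker, mul_zero]
    simp only [Matrix.mulVec, dotProduct, Matrix.map_apply, Pi.zero_apply]
    exact_mod_cast h
  · obtain ⟨z, h⟩ := hz i
    exact ⟨z, by simp only [h, Rat.cast_natCast]⟩
end
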